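/- Let n ≥ 1, N = 2^n, and let Φ = (φ_{ij})_{0≤i,j≤n-1} be a real n×n matrix such that φ_{ii} = 2^{n-1} for all i, φ_{ij} is an integer multiple of 2^n whenever i < j, and φ_{ij} is an arbitrary real number whenever i > j. Then the N×N complex matrix G_N whose (y,x) entry is (1/√N) exp(2πi (yΦxᵀ)/N), where x, y range over {0,1}^n and yΦxᵀ = Σ_{i,j} y_i φ_{ij} x_j, is unitary. -/

import Mathlib

open Complex in
/-- Orthogonality of characters of a bit vector: the sum factors over the coordinates. -/
theorem sum_bits_exp_eq_prod {n : ℕ} (a : Fin n → ℝ) :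
    ∑ x : Fin n → Fin 2, exp (((∑ j, a j * ((x j : ℕ) : ℝ) : ℝ) : ℂ) * I) =
      ∏ j, (1 + exp ((a j : ℂ) * I)) := by
  have h : ∀ j, 1 + exp ((a j : ℂ) * I) = ∑ b : Fin 2, exp ((a j : ℂ) * ((b : ℕ) : ℂ) * I) := by
    intro j
    simp [Fin.sum_univ_two]
  simp_rw [h]
  rw [Finset.prod_univ_sum, Fintype.piFinset_univ]
  refine Finset.sum_congr rfl fun x _ => ?_
  rw [← exp_sum]
  push_cast
  rw [Finset.sum_mul]

/-- At the last coordinate where two bit vectors differ, the weighted column sum of their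
difference is a half-integer multiple of `2 ^ n`. -/
theorem exists_column_sum_half_integer {n : ℕ} (hn : 1 ≤ n) (Φ : Matrix (Fin n) (Fin n) ℝ)
    (hdiag : ∀ i, Φ i i = 2 ^ (n - 1))
    (hupper : ∀ i j, i < j → ∃ k : ℤ, Φ i j = (k : ℝ) * 2 ^ n)
    {y z : Fin n → Fin 2} (hyz : y ≠ z) :
    ∃ j, ∃ m : ℤ, ∑ i, (((y i : ℕ) : ℝ) - ((z i : ℕ) : ℝ)) * Φ i j =
      2 ^ n * ((m : ℝ) + 1 / 2) := by
  classical
  obtain ⟨i₀, hi₀⟩ := Function.ne_iff.mp hyz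
  obtain ⟨j, hj, hmax⟩ := Finset.exists_max_image (Finset.univ.filter fun i => y i ≠ z i) id
    ⟨i₀, by simpa using hi₀⟩
  have hj : y j ≠ z j := by simpa using hj
  have hlast : ∀ i, j < i → y i = z i := by
    intro i hi
    by_contra hne
    exact absurd (hmax i (by simpa using hne)) (not_le.mpr hi)
  have hpow : (2 : ℝ) ^ n = 2 * 2 ^ (n - 1) := by
    rw [← pow_succ', Nat.sub_add_cancel hn]
  have hterm : ∀ i, ∃ m : ℤ, (((y i : ℕ) : ℝ) - ((z i : ℕ) : ℝ)) * Φ i j =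
      2 ^ n * ((m : ℝ) + if i = j then 1 / 2 else 0) := by
    intro i
    rcases lt_trichotomy i j with hij | rfl | hij
    · obtain ⟨k, hk⟩ := hupper i j hij
      refine ⟨((y i : ℕ) - (z i : ℕ)) * k, ?_⟩
      rw [hk, if_neg hij.ne]
      push_cast
      ring
    · have hcases : ∀ a b : Fin 2, a ≠ b → (a = 1 ∧ b = 0) ∨ (a = 0 ∧ b = 1) := by decide
      rcases hcases _ _ hj with ⟨h₁, h₂⟩ | ⟨h₁, h₂⟩
      · refine ⟨0, ?_⟩
        rw [h₁, h₂, hdiag, hpow]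
        norm_num
        ring
      · refine ⟨-1, ?_⟩
        rw [h₁, h₂, hdiag, hpow]
        norm_num
        ring
    · refine ⟨0, ?_⟩
      rw [hlast i hij, if_neg hij.ne']
      simp
  choose m hm using hterm
  refine ⟨j, ∑ i, m i, ?_⟩
  rw [Finset.sum_congr rfl fun i _ => hm i, ← Finset.mul_sum, Finset.sum_add_distrib]
  simp

/-- Let `n ≥ 1`, `N = 2^n`, and let `Φ` be a real `n×n` matrix with
`φ_{ii} = 2^{n-1}`, `φ_{ij}` an integer multiple of `2^n` for `i < j`, and `φ_{ij}`
arbitrary for `i > j`. Then the `N×N` matrix with `(y,x)` entry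
`(1/√N) exp(2πi (yΦxᵀ)/N)` is unitary. -/
theorem generalized_qft_stmt_1 (n : ℕ) (hn : 1 ≤ n)
    (Φ : Matrix (Fin n) (Fin n) ℝ)
    (hdiag : ∀ i, Φ i i = 2 ^ (n - 1))
    (hupper : ∀ i j, i < j → ∃ k : ℤ, Φ i j = (k : ℝ) * 2 ^ n)
    (G : Matrix (Fin n → Fin 2) (Fin n → Fin 2) ℂ)
    (hG : ∀ y x : Fin n → Fin 2,
      G y x = ((1 / Real.sqrt (2 ^ n) : ℝ) : ℂ) *
        Complex.exp (2 * (Real.pi : ℂ) * Complex.I *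
          ((∑ i, ∑ j, ((y i : ℕ) : ℝ) * Φ i j * ((x j : ℕ) : ℝ) : ℝ) : ℂ) / (2 : ℂ) ^ n)) :
    G ∈ Matrix.unitaryGroup (Fin n → Fin 2) ℂ := by
  set a : (Fin n → Fin 2) → Fin n → ℝ := fun y j =>
    2 * Real.pi / 2 ^ n * ∑ i, ((y i : ℕ) : ℝ) * Φ i j with ha
  have hG' : ∀ y x, G y x = ((1 / Real.sqrt (2 ^ n) : ℝ) : ℂ) *
      Complex.exp (((∑ j, a y j * ((x j : ℕ) : ℝ) : ℝ) : ℂ) * Complex.I) := by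
    intro y x
    have hsum : ∑ j, a y j * ((x j : ℕ) : ℝ) =
        2 * Real.pi / 2 ^ n * ∑ i, ∑ j, ((y i : ℕ) : ℝ) * Φ i j * ((x j : ℕ) : ℝ) := by
      rw [Finset.sum_comm, Finset.mul_sum]
      refine Finset.sum_congr rfl fun j _ => ?_
      rw [← Finset.sum_mul, mul_assoc]
    rw [hG, hsum, Complex.ofReal_mul]
    congr 2
    push_cast
    ring
  have hsq : ((1 / Real.sqrt (2 ^ n) : ℝ) : ℂ) * ((1 / Real.sqrt (2 ^ n) : ℝ) : ℂ) =
      1 / 2 ^ n := by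
    rw [← Complex.ofReal_mul, div_mul_div_comm, Real.mul_self_sqrt (by positivity)]
    push_cast
    ring
  have hentry : ∀ y z x, G y x * star (G z x) = 1 / 2 ^ n *
      Complex.exp (((∑ j, (a y j - a z j) * ((x j : ℕ) : ℝ) : ℝ) : ℂ) * Complex.I) := by
    intro y z x
    rw [hG', hG', ← hsq, Complex.star_def, map_mul, Complex.conj_ofReal, ← Complex.exp_conj,
      map_mul, Complex.conj_ofReal, Complex.conj_I, mul_mul_mul_comm, ← Complex.exp_add]
    simp_rw [sub_mul]
    rw [Finset.sum_sub_distrib, Complex.ofReal_sub]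
    congr 2
    ring
  rw [Matrix.mem_unitaryGroup_iff]
  ext y z
  simp_rw [Matrix.mul_apply, Matrix.star_apply, hentry]
  rw [← Finset.mul_sum, sum_bits_exp_eq_prod]
  by_cases hyz : y = z
  · subst hyz
    simp [one_add_one_eq_two]
  · obtain ⟨j, m, hm⟩ := exists_column_sum_half_integer hn Φ hdiag hupper hyz
    have hdiff : a y j - a z j = Real.pi + m * (2 * Real.pi) := by
      simp_rw [sub_mul] at hm
      rw [Finset.sum_sub_distrib] at hm
      simp only [ha]
      rw [← mul_sub, hm]
      field_simp
      ring
    have hexp : Complex.exp (((a y j - a z j : ℝ) : ℂ) * Complex.I) = -1 := by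
      rw [hdiff, ← Complex.exp_pi_mul_I, Complex.exp_eq_exp_iff_exists_int]
      refine ⟨m, ?_⟩
      push_cast
      ring
    rw [Matrix.one_apply_ne hyz, Finset.prod_eq_zero (Finset.mem_univ j) (by rw [hexp]; ring),
      mul_zero]
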